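/- arXiv:2306.01718 — 2 statements merged into one kernel-verified Lean document; each statement's English description precedes it below -/
import Mathlib

section
/- Let T ∈ F^{n1} ⊗ F^{n2} ⊗ F^{n3} be a concise tensor over a field F with n1 ≤ n2 ≤ n3 and |F| > n3. Then there exist distinct i, j ∈ {1,2,3} such that Q_i(T) ≥ √n3 and Q_j(T) ≥ √n1. -/
open scoped BigOperators

namespace Paper

variable {F : Type*} [Field F]

/-- Restriction of order-three tensors: `T ≥ S` iff there exist linear maps
(given by matrices `L1, L2, L3`) carrying `T` to `S`. -/
def Restricts {ι1 ι2 ι3 κ1 κ2 κ3 : Type*} [Fintype ι1] [Fintype ι2] [Fintype ι3]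
    (T : ι1 → ι2 → ι3 → F) (S : κ1 → κ2 → κ3 → F) : Prop :=
  ∃ (L1 : κ1 → ι1 → F) (L2 : κ2 → ι2 → F) (L3 : κ3 → ι3 → F),
    ∀ a b c, S a b c = ∑ i, ∑ j, ∑ k, L1 a i * L2 b j * L3 c k * T i j k

/-- The unit (diagonal) tensor `⟨r⟩`. -/
def unitTensor (F : Type*) [Field F] (r : ℕ) : Fin r → Fin r → Fin r → F :=
  fun i j k => if i = j ∧ j = k then 1 else 0

/-- The subrank `Q(T)`: the largest `r` such that `T` restricts to `⟨r⟩`. -/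
noncomputable def subrank {ι1 ι2 ι3 : Type*} [Fintype ι1] [Fintype ι2] [Fintype ι3]
    (T : ι1 → ι2 → ι3 → F) : ℕ :=
  sSup {r : ℕ | Restricts T (unitTensor F r)}

/-- Kronecker (tensor) power `T^{⊠ m}` of an order-three tensor. -/
def kronPow {ι1 ι2 ι3 : Type*} (T : ι1 → ι2 → ι3 → F) (m : ℕ) :
    (Fin m → ι1) → (Fin m → ι2) → (Fin m → ι3) → F :=
  fun x y z => ∏ s : Fin m, T (x s) (y s) (z s)

/-- Asymptotic subrank `Q~(T) = lim_n Q(T^{⊠n})^{1/n} = sup_n Q(T^{⊠n})^{1/n}`. -/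
noncomputable def asympSubrank {ι1 ι2 ι3 : Type*} [Fintype ι1] [Fintype ι2] [Fintype ι3]
    (T : ι1 → ι2 → ι3 → F) : ℝ :=
  ⨆ m : ℕ, (subrank (kronPow T (m + 1)) : ℝ) ^ ((1 : ℝ) / (m + 1))

/-- First flattening of a tensor. -/
def flattening1 {ι1 ι2 ι3 : Type*} (T : ι1 → ι2 → ι3 → F) : Matrix ι1 (ι2 × ι3) F :=
  Matrix.of fun i p => T i p.1 p.2

/-- Second flattening of a tensor. -/
def flattening2 {ι1 ι2 ι3 : Type*} (T : ι1 → ι2 → ι3 → F) : Matrix ι2 (ι1 × ι3) F :=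
  Matrix.of fun j p => T p.1 j p.2

/-- Third flattening of a tensor. -/
def flattening3 {ι1 ι2 ι3 : Type*} (T : ι1 → ι2 → ι3 → F) : Matrix ι3 (ι1 × ι2) F :=
  Matrix.of fun k p => T p.1 p.2 k

/-- A tensor is concise if all three flattening ranks are maximal. -/
noncomputable def Concise {ι1 ι2 ι3 : Type*} [Fintype ι1] [Fintype ι2] [Fintype ι3]
    (T : ι1 → ι2 → ι3 → F) : Prop :=
  (flattening1 T).rank = Fintype.card ι1 ∧
  (flattening2 T).rank = Fintype.card ι2 ∧
  (flattening3 T).rank = Fintype.card ι3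

/-- A tensor has slice rank one if one of its flattenings has rank one. -/
noncomputable def SliceRankOne {ι1 ι2 ι3 : Type*} [Fintype ι1] [Fintype ι2] [Fintype ι3]
    (T : ι1 → ι2 → ι3 → F) : Prop :=
  (flattening1 T).rank = 1 ∨ (flattening2 T).rank = 1 ∨ (flattening3 T).rank = 1

/-- The slice rank `SR(T)`: the least `r` such that `T` is a sum of `r` slice-rank-one
tensors. -/
noncomputable def sliceRank {ι1 ι2 ι3 : Type*} [Fintype ι1] [Fintype ι2] [Fintype ι3]
    (T : ι1 → ι2 → ι3 → F) : ℕ :=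
  sInf {r : ℕ | ∃ f : Fin r → (ι1 → ι2 → ι3 → F),
    (∀ t, SliceRankOne (f t)) ∧ T = ∑ t, f t}

/-- The liminf-asymptotic slice rank. -/
noncomputable def asympSliceRankInf {ι1 ι2 ι3 : Type*} [Fintype ι1] [Fintype ι2] [Fintype ι3]
    (T : ι1 → ι2 → ι3 → F) : ℝ :=
  Filter.liminf (fun m : ℕ => (sliceRank (kronPow T m) : ℝ) ^ ((1 : ℝ) / m)) Filter.atTop

/-- The limsup-asymptotic slice rank. -/
noncomputable def asympSliceRankSup {ι1 ι2 ι3 : Type*} [Fintype ι1] [Fintype ι2] [Fintype ι3]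
    (T : ι1 → ι2 → ι3 → F) : ℝ :=
  Filter.limsup (fun m : ℕ => (sliceRank (kronPow T m) : ℝ) ^ ((1 : ℝ) / m)) Filter.atTop

/-- The max-rank of a matrix subspace. -/
noncomputable def maxrank {m n : Type*} [Fintype n] (𝒜 : Submodule F (Matrix m n F)) : ℕ :=
  sSup {r : ℕ | ∃ A ∈ 𝒜, A.rank = r}

/-- The min-rank of a matrix subspace: the least rank of a nonzero element. -/
noncomputable def minrank {m n : Type*} [Fintype n] (𝒜 : Submodule F (Matrix m n F)) : ℕ :=
  sInf {r : ℕ | ∃ A ∈ 𝒜, A ≠ 0 ∧ A.rank = r}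

section Slices

variable {n1 n2 n3 : ℕ}

/-- Span of the 3-slices, rows indexed by direction 1, columns by direction 2. -/
def span12 (T : Fin n1 → Fin n2 → Fin n3 → F) : Submodule F (Matrix (Fin n1) (Fin n2) F) :=
  Submodule.span F (Set.range fun k : Fin n3 => Matrix.of fun i j => T i j k)

/-- Span of the 3-slices, rows indexed by direction 2, columns by direction 1. -/
def span21 (T : Fin n1 → Fin n2 → Fin n3 → F) : Submodule F (Matrix (Fin n2) (Fin n1) F) :=
  Submodule.span F (Set.range fun k : Fin n3 => Matrix.of fun j i => T i j k)

/-- Span of the 2-slices, rows indexed by direction 1, columns by direction 3. -/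
def span13 (T : Fin n1 → Fin n2 → Fin n3 → F) : Submodule F (Matrix (Fin n1) (Fin n3) F) :=
  Submodule.span F (Set.range fun j : Fin n2 => Matrix.of fun i k => T i j k)

/-- Span of the 2-slices, rows indexed by direction 3, columns by direction 1. -/
def span31 (T : Fin n1 → Fin n2 → Fin n3 → F) : Submodule F (Matrix (Fin n3) (Fin n1) F) :=
  Submodule.span F (Set.range fun j : Fin n2 => Matrix.of fun k i => T i j k)

/-- Span of the 1-slices, rows indexed by direction 2, columns by direction 3. -/
def span23 (T : Fin n1 → Fin n2 → Fin n3 → F) : Submodule F (Matrix (Fin n2) (Fin n3) F) :=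
  Submodule.span F (Set.range fun i : Fin n1 => Matrix.of fun j k => T i j k)

/-- Span of the 1-slices, rows indexed by direction 3, columns by direction 2. -/
def span32 (T : Fin n1 → Fin n2 → Fin n3 → F) : Submodule F (Matrix (Fin n3) (Fin n2) F) :=
  Submodule.span F (Set.range fun i : Fin n1 => Matrix.of fun k j => T i j k)

/-- `Q_1(T)`: max-rank of the span of the 1-slices. -/
noncomputable def Q1 (T : Fin n1 → Fin n2 → Fin n3 → F) : ℕ := maxrank (span23 T)

/-- `Q_2(T)`: max-rank of the span of the 2-slices. -/
noncomputable def Q2 (T : Fin n1 → Fin n2 → Fin n3 → F) : ℕ := maxrank (span13 T)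

/-- `Q_3(T)`: max-rank of the span of the 3-slices. -/
noncomputable def Q3 (T : Fin n1 → Fin n2 → Fin n3 → F) : ℕ := maxrank (span12 T)

end Slices

/-- `p` is the pivot of the matrix `A`: the lexicographically least position of a
nonzero entry. -/
def IsPivot {n1 n2 : ℕ} (A : Matrix (Fin n1) (Fin n2) F) (p : Fin n1 × Fin n2) : Prop :=
  A p.1 p.2 ≠ 0 ∧ ∀ q : Fin n1 × Fin n2, A q.1 q.2 ≠ 0 → p.1 < q.1 ∨ (p.1 = q.1 ∧ p.2 ≤ q.2)

/-- The set of pivots of a matrix subspace (equal to the pivots of any basis with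
pairwise distinct pivots). -/
def pivotSet {n1 n2 : ℕ} (𝒜 : Submodule F (Matrix (Fin n1) (Fin n2) F)) :
    Set (Fin n1 × Fin n2) :=
  {p | ∃ A ∈ 𝒜, IsPivot A p}

/-- `ρ(𝒜)`: the least `r = |S1| + |S2|` such that the pivots of `𝒜` are covered by the
rows `S1` and columns `S2`. -/
noncomputable def rho {n1 n2 : ℕ} (𝒜 : Submodule F (Matrix (Fin n1) (Fin n2) F)) : ℕ :=
  sInf {r : ℕ | ∃ (S1 : Finset (Fin n1)) (S2 : Finset (Fin n2)),
    S1.card + S2.card = r ∧ ∀ p ∈ pivotSet 𝒜, p.1 ∈ S1 ∨ p.2 ∈ S2}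

/-- The border subrank `Q̲(T)`: the largest `r` such that, over Laurent polynomials
in `ε`, some restriction of `T` equals `⟨r⟩ + ε S_1 + ⋯ + ε^t S_t`. -/
noncomputable def borderSubrank {ι1 ι2 ι3 : Type*} [Fintype ι1] [Fintype ι2] [Fintype ι3]
    (T : ι1 → ι2 → ι3 → F) : ℕ :=
  sSup {r : ℕ |
    ∃ (A : Fin r → ι1 → LaurentPolynomial F) (B : Fin r → ι2 → LaurentPolynomial F)
      (C : Fin r → ι3 → LaurentPolynomial F) (t : ℕ)
      (S : Fin t → (Fin r → Fin r → Fin r → F)),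
      ∀ a b c,
        (∑ i, ∑ j, ∑ k, A a i * B b j * C c k * LaurentPolynomial.C (T i j k)) =
          LaurentPolynomial.C (unitTensor F r a b c) +
            ∑ s : Fin t, LaurentPolynomial.T (((s : ℕ) : ℤ) + 1) *
              LaurentPolynomial.C (S s a b c)}

/-- The linear map `A ↦ U * A * V` on rectangular matrices. -/
def conjMap {n1 n2 : ℕ} (U : Matrix (Fin n1) (Fin n1) F) (V : Matrix (Fin n2) (Fin n2) F) :
    Matrix (Fin n1) (Fin n2) F →ₗ[F] Matrix (Fin n1) (Fin n2) F where
  toFun A := U * A * V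
  map_add' A B := by simp [Matrix.mul_add, Matrix.add_mul]
  map_smul' c A := by simp [Matrix.mul_smul, Matrix.smul_mul]

/-- The principal submatrix `A_{J×J}`, where `J ⊆ [min{n1,n2}]` is encoded by the
map `η`. -/
def restrictJJ {n1 n2 jn : ℕ} (η : Fin jn → Fin (min n1 n2))
    (A : Matrix (Fin n1) (Fin n2) F) : Matrix (Fin jn) (Fin jn) F :=
  Matrix.of fun p q =>
    A (Fin.castLE (min_le_left n1 n2) (η p)) (Fin.castLE (min_le_right n1 n2) (η q))

/-- An order-three tensor over `F` of arbitrary format. -/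
structure Tensor3 (F : Type*) [Field F] where
  n1 : ℕ
  n2 : ℕ
  n3 : ℕ
  coef : Fin n1 → Fin n2 → Fin n3 → F

/-- Two tensors are equivalent if each restricts to the other. -/
def Tensor3.Equivalent (T S : Tensor3 F) : Prop :=
  Restricts T.coef S.coef ∧ Restricts S.coef T.coef

/-- A rank-one order-`k` tensor: a tensor product of `k` nonzero vectors. -/
def RankOne {k : ℕ} {ι : Fin k → Type*} (T : ((i : Fin k) → ι i) → F) : Prop :=
  ∃ u : (i : Fin k) → (ι i → F), (∀ i, u i ≠ 0) ∧ ∀ v, T v = ∏ i, u i (v i)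

/-- The tensor rank of an order-`k` tensor. -/
noncomputable def tensorRank {k : ℕ} {ι : Fin k → Type*} (T : ((i : Fin k) → ι i) → F) : ℕ :=
  sInf {r : ℕ | ∃ f : Fin r → (((i : Fin k) → ι i) → F),
    (∀ t, RankOne (f t)) ∧ T = ∑ t, f t}

/-- Kronecker power of an order-`k` tensor. -/
def kronPowK {k : ℕ} {ι : Fin k → Type*} (T : ((i : Fin k) → ι i) → F) (m : ℕ) :
    ((i : Fin k) → (Fin m → ι i)) → F :=
  fun v => ∏ s : Fin m, T fun i => v i s

/-- The asymptotic rank `R~(T) = lim_n R(T^{⊠n})^{1/n} = inf_n R(T^{⊠n})^{1/n}`. -/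
noncomputable def asympRank {k : ℕ} {ι : Fin k → Type*} (T : ((i : Fin k) → ι i) → F) : ℝ :=
  ⨅ m : ℕ, (tensorRank (kronPowK T (m + 1)) : ℝ) ^ ((1 : ℝ) / (m + 1))

section MaxRank

open Module

/-- If `A` has maximal rank in the affine pencil `s • A + B` over a field with more than
`rank A` elements, then `B` maps the kernel of `A` into the range of `A`. -/
theorem apply_mem_range_of_forall_finrank_range_le {K V W : Type*} [Field K]
    [AddCommGroup V] [Module K V] [AddCommGroup W] [Module K W] [FiniteDimensional K W]
    (A B : V →ₗ[K] W)
    (h : ∀ s : K, finrank K (LinearMap.range (s • A + B)) ≤ finrank K (LinearMap.range A))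
    (hK : (finrank K (LinearMap.range A) : Cardinal) < Cardinal.mk K)
    {v : V} (hv : A v = 0) : B v ∈ LinearMap.range A := by
  by_contra hB
  set R := LinearMap.range A with hR
  set S : Submodule K W := Submodule.span K {B v}
  have hinj : LinearMap.ker (S.mkQ ∘ₗ R.subtype) = ⊥ := by
    rw [LinearMap.ker_eq_bot']
    rintro ⟨x, hx⟩ hx0
    have hxS : x ∈ S := by simpa using hx0
    obtain ⟨c, rfl⟩ := Submodule.mem_span_singleton.1 hxS
    rcases eq_or_ne c 0 with rfl | hc
    · simp
    · exact absurd ((R.smul_mem_iff hc).1 hx) hB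
  obtain ⟨g, hg⟩ := LinearMap.exists_leftInverse_of_injective _ hinj
  obtain ⟨σ, hσ⟩ := A.rangeRestrict.exists_rightInverse_of_surjective A.range_rangeRestrict
  set π : W →ₗ[K] R := g ∘ₗ S.mkQ
  have hπB : π (B v) = 0 := by
    have : S.mkQ (B v) = 0 := by
      simp [S]
    simp only [π, LinearMap.comp_apply, this, map_zero]
  have hπA (x : R) : π (A (σ x)) = x := by
    have h1 : A (σ x) = x := congrArg Subtype.val (LinearMap.congr_fun hσ x)
    rw [h1]
    exact LinearMap.congr_fun hg x
  set N : End K R := -(π ∘ₗ B ∘ₗ σ) with hN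
  obtain ⟨s, hs⟩ := N.charpoly.exists_eval_ne_zero_of_natDegree_lt_card
    N.charpoly_monic.ne_zero (by rwa [N.charpoly_natDegree])
  set C := s • A + B with hC
  have hker : LinearMap.ker (π ∘ₗ C ∘ₗ σ) = ⊥ := by
    rw [LinearMap.ker_eq_bot']
    intro x hx
    by_contra hx0
    refine hs ((Module.End.hasEigenvalue_iff_isRoot_charpoly N s).1
      (Module.End.hasEigenvalue_of_hasEigenvector (x := x)
        (Module.End.hasEigenvector_iff.2 ⟨Module.End.mem_eigenspace_iff.2 ?_, hx0⟩)))
    have : s • x + π (B (σ x)) = 0 := by simpa [hC, hπA] using hx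
    simpa [hN, neg_eq_iff_add_eq_zero, add_comm] using this
  have hsurj : Function.Surjective (π ∘ₗ C ∘ₗ σ) :=
    LinearMap.injective_iff_surjective.1 (LinearMap.ker_eq_bot.1 hker)
  have hrange : LinearMap.range (π.domRestrict (LinearMap.range C)) = ⊤ := by
    rw [LinearMap.range_eq_top]
    intro y
    obtain ⟨x, hx⟩ := hsurj y
    exact ⟨⟨C (σ x), LinearMap.mem_range_self _ _⟩, hx⟩
  have hrn := LinearMap.finrank_range_add_finrank_ker (π.domRestrict (LinearMap.range C))
  rw [hrange, finrank_top] at hrn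
  have hCv : B v ∈ LinearMap.range C := ⟨v, by simp [hC, hv]⟩
  have hpos : 0 < finrank K (LinearMap.ker (π.domRestrict (LinearMap.range C))) := by
    rw [finrank_pos_iff_exists_ne_zero]
    refine ⟨⟨⟨B v, hCv⟩, hπB⟩, fun h0 => hB ?_⟩
    have : B v = 0 := congrArg (fun z => (z.1 : W)) h0
    rw [this]
    exact R.zero_mem
  have : finrank K (LinearMap.range C) ≤ finrank K R := h s
  omega

/-- The span of the image of a bilinear map has dimension at most the product of the maximal
ranks of its two families of partial maps. -/
theorem finrank_span_range_le_mul {K U V W : Type*} [Field K]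
    [AddCommGroup U] [Module K U] [AddCommGroup V] [Module K V]
    [AddCommGroup W] [Module K W] [FiniteDimensional K W]
    (hK : (finrank K W : Cardinal) < Cardinal.mk K) (f : U →ₗ[K] V →ₗ[K] W) {r s : ℕ}
    (hr : ∀ a, finrank K (LinearMap.range (f a)) ≤ r)
    (hs : ∀ b, finrank K (LinearMap.range (f.flip b)) ≤ s) :
    finrank K (Submodule.span K (Set.range fun p : U × V => f p.1 p.2)) ≤ r * s := by
  obtain ⟨a, ha⟩ : ∃ a, ∀ a', finrank K (LinearMap.range (f a')) ≤
      finrank K (LinearMap.range (f a)) := by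
    have hfin : (Set.range fun a => finrank K (LinearMap.range (f a))).Finite :=
      (Set.finite_Iic r).subset (by rintro _ ⟨a, rfl⟩; exact hr a)
    obtain ⟨_, ⟨a, rfl⟩, ha⟩ := hfin.exists_maximal (Set.range_nonempty _)
    exact ⟨a, fun a' => (le_total _ _).elim id (ha ⟨a', rfl⟩)⟩
  set R := LinearMap.range (f a)
  obtain ⟨σ, hσ⟩ := (f a).rangeRestrict.exists_rightInverse_of_surjective
    (f a).range_rangeRestrict
  have hfσ (x : R) : f a (σ x) = x := congrArg Subtype.val (LinearMap.congr_fun hσ x)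
  set e := finBasis K R
  set P := fun i => LinearMap.range (f.flip (σ (e i)))
  have hσP (a' : U) (x : R) : f a' (σ x) ∈ ⨆ i, P i := by
    rw [← e.sum_repr x, map_sum, map_sum]
    refine Submodule.sum_mem _ fun i _ => ?_
    rw [map_smul, map_smul]
    exact Submodule.smul_mem _ _ (Submodule.mem_iSup_of_mem i ⟨a', rfl⟩)
  have hspan : Submodule.span K (Set.range fun p : U × V => f p.1 p.2) ≤ ⨆ i, P i := by
    rw [Submodule.span_le]
    rintro _ ⟨⟨a', b⟩, rfl⟩
    set x : R := ⟨f a b, LinearMap.mem_range_self _ _⟩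
    have hmem : f a' (b - σ x) ∈ R := by
      refine apply_mem_range_of_forall_finrank_range_le (f a) (f a') (fun t => ?_)
        (lt_of_le_of_lt (by exact_mod_cast R.finrank_le) hK) ?_
      · rw [← map_smul, ← map_add]
        exact ha _
      · rw [map_sub, hfσ, sub_self]
    have hsum : f a' b = f a (σ ⟨_, hmem⟩) + f a' (σ x) := by
      rw [hfσ, ← map_add, sub_add_cancel]
    change f a' b ∈ _
    rw [hsum]
    exact Submodule.add_mem _ (hσP a _) (hσP a' x)
  calc _ ≤ finrank K (⨆ i, P i : Submodule K W) := Submodule.finrank_mono hspan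
    _ ≤ ∑ i, finrank K (P i) := by
        rw [← Finset.sup_univ_eq_iSup]
        refine Finset.induction_on (Finset.univ : Finset (Fin (finrank K R))) (by simp)
          fun i t hi ih => ?_
        rw [Finset.sup_insert, Finset.sum_insert hi]
        exact (Submodule.finrank_add_le_finrank_add_finrank _ _).trans (by gcongr)
    _ ≤ ∑ _i : Fin (finrank K R), s := Finset.sum_le_sum fun i _ => hs _
    _ ≤ r * s := by simpa using Nat.mul_le_mul_right s (hr a)

/-- The rank of the third flattening is at most the product of the maximal ranks of linear
combinations of the slices in the other two directions. -/
theorem rank_flattening3_le_mul {ι1 ι2 ι3 : Type*} [Fintype ι1] [Fintype ι2] [Fintype ι3]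
    (hF : (Fintype.card ι3 : Cardinal) < Cardinal.mk F) (T : ι1 → ι2 → ι3 → F) {r s : ℕ}
    (hr : ∀ a : ι1 → F, (Matrix.of fun j k => ∑ i, a i * T i j k : Matrix ι2 ι3 F).rank ≤ r)
    (hs : ∀ b : ι2 → F, (Matrix.of fun i k => ∑ j, b j * T i j k : Matrix ι1 ι3 F).rank ≤ s) :
    (flattening3 T).rank ≤ r * s := by
  classical
  let f : (ι1 → F) →ₗ[F] (ι2 → F) →ₗ[F] ι3 → F :=
    LinearMap.mk₂ F (fun a b k => ∑ i, ∑ j, a i * b j * T i j k)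
      (fun _ _ _ => by ext; simp [add_mul, Finset.sum_add_distrib])
      (fun _ _ _ => by ext; simp [Finset.mul_sum, mul_assoc])
      (fun _ _ _ => by ext; simp [add_mul, mul_add, Finset.sum_add_distrib])
      (fun _ _ _ => by ext; simp [Finset.mul_sum, mul_assoc, mul_left_comm])
  have hf1 (a : ι1 → F) : f a =
      (Matrix.of fun j k => ∑ i, a i * T i j k : Matrix ι2 ι3 F).transpose.mulVecLin := by
    ext b k
    simp [f, Pi.single_apply]
  have hf2 (b : ι2 → F) : f.flip b =
      (Matrix.of fun i k => ∑ j, b j * T i j k : Matrix ι1 ι3 F).transpose.mulVecLin := by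
    ext a k
    simp [f, Pi.single_apply]
  have hspan := finrank_span_range_le_mul (by simpa using hF) f (r := r) (s := s)
    (fun a => by rw [hf1]; exact (Matrix.rank_transpose _).trans_le (hr a))
    (fun b => by rw [hf2]; exact (Matrix.rank_transpose _).trans_le (hs b))
  refine le_trans ?_ hspan
  rw [Matrix.rank_eq_finrank_span_cols]
  refine Submodule.finrank_mono (Submodule.span_mono ?_)
  rintro _ ⟨⟨i, j⟩, rfl⟩
  refine ⟨(Pi.single i 1, Pi.single j 1), ?_⟩
  ext k
  simp [f, flattening3, Pi.single_apply]

theorem rank_le_maxrank {m n : Type*} [Fintype n] {𝒜 : Submodule F (Matrix m n F)}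
    {A : Matrix m n F} (hA : A ∈ 𝒜) : A.rank ≤ maxrank 𝒜 :=
  le_csSup ⟨Fintype.card n, by rintro _ ⟨B, -, rfl⟩; exact B.rank_le_card_width⟩ ⟨A, hA, rfl⟩

variable {n1 n2 n3 : ℕ} (T : Fin n1 → Fin n2 → Fin n3 → F)

theorem rank_sum_slices_le_Q1 (a : Fin n1 → F) :
    (Matrix.of fun j k => ∑ i, a i * T i j k).rank ≤ Q1 T := by
  refine rank_le_maxrank (𝒜 := span23 T) ?_
  have : (Matrix.of fun j k => ∑ i, a i * T i j k) = ∑ i, a i • Matrix.of fun j k => T i j k := by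
    ext; simp [Matrix.sum_apply]
  rw [this]
  exact Submodule.sum_mem _ fun i _ =>
    Submodule.smul_mem _ _ (Submodule.subset_span (Set.mem_range_self i))

theorem rank_sum_slices_le_Q2 (b : Fin n2 → F) :
    (Matrix.of fun i k => ∑ j, b j * T i j k).rank ≤ Q2 T := by
  refine rank_le_maxrank (𝒜 := span13 T) ?_
  have : (Matrix.of fun i k => ∑ j, b j * T i j k) = ∑ j, b j • Matrix.of fun i k => T i j k := by
    ext; simp [Matrix.sum_apply]
  rw [this]
  exact Submodule.sum_mem _ fun j _ =>
    Submodule.smul_mem _ _ (Submodule.subset_span (Set.mem_range_self j))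

theorem rank_sum_slices_le_Q3 (c : Fin n3 → F) :
    (Matrix.of fun i j => ∑ k, c k * T i j k).rank ≤ Q3 T := by
  refine rank_le_maxrank (𝒜 := span12 T) ?_
  have : (Matrix.of fun i j => ∑ k, c k * T i j k) = ∑ k, c k • Matrix.of fun i j => T i j k := by
    ext; simp [Matrix.sum_apply]
  rw [this]
  exact Submodule.sum_mem _ fun k _ =>
    Submodule.smul_mem _ _ (Submodule.subset_span (Set.mem_range_self k))

theorem rank_flattening3_le_Q1_mul_Q2 (hF : (n3 : Cardinal) < Cardinal.mk F) :
    (flattening3 T).rank ≤ Q1 T * Q2 T :=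
  rank_flattening3_le_mul (by simpa using hF) T (rank_sum_slices_le_Q1 T)
    (rank_sum_slices_le_Q2 T)

theorem rank_flattening2_le_Q1_mul_Q3 (hF : (n2 : Cardinal) < Cardinal.mk F) :
    (flattening2 T).rank ≤ Q1 T * Q3 T :=
  rank_flattening3_le_mul (by simpa using hF) (fun i k j => T i j k)
    (fun a => (Matrix.rank_transpose _).symm.trans_le (rank_sum_slices_le_Q1 T a))
    (rank_sum_slices_le_Q3 T)

theorem rank_flattening1_le_Q2_mul_Q3 (hF : (n1 : Cardinal) < Cardinal.mk F) :
    (flattening1 T).rank ≤ Q2 T * Q3 T :=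
  rank_flattening3_le_mul (by simpa using hF) (fun j k i => T i j k)
    (fun b => (Matrix.rank_transpose _).symm.trans_le (rank_sum_slices_le_Q2 T b))
    (fun c => (Matrix.rank_transpose _).symm.trans_le (rank_sum_slices_le_Q3 T c))

theorem sqrt_le_or_sqrt_le_of_le_mul {n a b : ℕ} (h : n ≤ a * b) :
    Real.sqrt n ≤ a ∨ Real.sqrt n ≤ b := by
  by_contra! hlt
  have h1 : (a : ℝ) * b < Real.sqrt n * Real.sqrt n :=
    mul_lt_mul'' hlt.1 hlt.2 a.cast_nonneg b.cast_nonneg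
  rw [Real.mul_self_sqrt n.cast_nonneg] at h1
  exact absurd h (not_le.2 (by exact_mod_cast h1))

end MaxRank

/-- For a concise tensor `T` of format `(n1, n2, n3)` with
`n1 ≤ n2 ≤ n3` and `|F| > n3`, there are two distinct directions `i, j` with
`Q_i(T) ≥ √n3` and `Q_j(T) ≥ √n1`. -/
theorem exists_two_directions_large_maxrank (F : Type*) [Field F] (n1 n2 n3 : ℕ)
    (T : Fin n1 → Fin n2 → Fin n3 → F) (hT : Concise T)
    (h12 : n1 ≤ n2) (h23 : n2 ≤ n3)
    (hF : ((n3 : ℕ) : Cardinal) < Cardinal.mk F) :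
    ∃ i j : Fin 3, i ≠ j ∧
      Real.sqrt n3 ≤ (![Q1 T, Q2 T, Q3 T] i : ℝ) ∧
      Real.sqrt n1 ≤ (![Q1 T, Q2 T, Q3 T] j : ℝ) := by
  obtain ⟨h1, h2, h3⟩ := hT
  rw [Fintype.card_fin] at h1 h2 h3
  have hF2 : (n2 : Cardinal) < Cardinal.mk F := lt_of_le_of_lt (by exact_mod_cast h23) hF
  have hF1 : (n1 : Cardinal) < Cardinal.mk F := lt_of_le_of_lt (by exact_mod_cast h12) hF2
  have h12Q : n3 ≤ Q1 T * Q2 T := h3.ge.trans (rank_flattening3_le_Q1_mul_Q2 T hF)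
  have h13Q : n1 ≤ Q1 T * Q3 T := h12.trans (h2.ge.trans (rank_flattening2_le_Q1_mul_Q3 T hF2))
  have h23Q : n1 ≤ Q2 T * Q3 T := h1.ge.trans (rank_flattening1_le_Q2_mul_Q3 T hF1)
  rcases sqrt_le_or_sqrt_le_of_le_mul h12Q with hi | hi
  · rcases sqrt_le_or_sqrt_le_of_le_mul h23Q with hj | hj
    · exact ⟨0, 1, by decide, by simpa using hi, by simpa using hj⟩
    · exact ⟨0, 2, by decide, by simpa using hi, by simpa using hj⟩
  · rcases sqrt_le_or_sqrt_le_of_le_mul h13Q with hj | hj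
    · exact ⟨1, 0, by decide, by simpa using hi, by simpa using hj⟩
    · exact ⟨1, 2, by decide, by simpa using hi, by simpa using hj⟩

end Paper
end

section
/- Let F be any field and let T ∈ F^{n1} ⊗ F^{n2} ⊗ F^{n3} be a concise tensor. Then the asymptotic subrank of T satisfies Q~(T) ≥ (min{n1, n2, n3})^(1/4). -/
open scoped BigOperators

namespace Paper

variable {F : Type*} [Field F]

/-! ### Compression of spaces of linear maps of bounded rank -/

section Compression

open Module Submodule

universe u v w

theorem finrank_comap_mkQ {V : Type u} [AddCommGroup V] [Module F V] [FiniteDimensional F V]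
    (W : Submodule F V) (P : Submodule F (V ⧸ W)) :
    finrank F (P.comap W.mkQ) = finrank F P + finrank F W := by
  have h := LinearMap.finrank_range_add_finrank_ker (W.mkQ.domRestrict (P.comap W.mkQ))
  have hr : LinearMap.range (W.mkQ.domRestrict (P.comap W.mkQ)) = P := by
    rw [LinearMap.range_domRestrict, map_comap_eq_of_surjective W.mkQ_surjective]
  have hk : finrank F (LinearMap.ker (W.mkQ.domRestrict (P.comap W.mkQ))) = finrank F W := by
    rw [LinearMap.ker_domRestrict, ker_mkQ]
    refine (submoduleOfEquivOfLe ?_).finrank_eq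
    intro x hx
    simp [(Quotient.mk_eq_zero W).2 hx]
  rw [hr, hk] at h
  exact h.symm

/-- If `A`, `B` and `A + B` all have rank at most `q = rank A`, then the block of `B` mapping
`ker A` to the quotient by `range A` has rank at most `q / 2`. -/
theorem finrank_residual_le {V : Type u} {W : Type v} [AddCommGroup V] [Module F V]
    [AddCommGroup W] [Module F W] [FiniteDimensional F V] [FiniteDimensional F W]
    (A B : V →ₗ[F] W) {q : ℕ} (hA : finrank F (LinearMap.range A) = q)
    (hB : finrank F (LinearMap.range B) ≤ q) (hAB : finrank F (LinearMap.range (A + B)) ≤ q) :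
    finrank F (((LinearMap.ker A).map B).map (LinearMap.range A).mkQ) ≤ q / 2 := by
  set Y := (LinearMap.ker A).map B
  have h1 := finrank_sup_add_finrank_inf_eq (LinearMap.range B) (LinearMap.range (A + B))
  have hYB : Y ≤ LinearMap.range B := LinearMap.map_le_range
  have hYAB : Y ≤ LinearMap.range (A + B) := by
    rintro _ ⟨x, hx, rfl⟩
    exact ⟨x, by simp [LinearMap.mem_ker.1 hx]⟩
  have h2 : finrank F Y ≤ finrank F (LinearMap.range B ⊓ LinearMap.range (A + B) : Submodule F W) :=
    finrank_mono (le_inf hYB hYAB)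
  have h3 : LinearMap.range A ⊔ Y ≤ LinearMap.range B ⊔ LinearMap.range (A + B) := by
    refine sup_le ?_ (hYB.trans le_sup_left)
    rintro _ ⟨x, rfl⟩
    have : A x = -(B x) + (A + B) x := by simp
    rw [this]
    exact add_mem_sup (neg_mem ⟨x, rfl⟩) ⟨x, rfl⟩
  have h4 := finrank_mono h3
  have h5 := finrank_comap_mkQ (LinearMap.range A) (Y.map (LinearMap.range A).mkQ)
  rw [comap_map_mkQ] at h5
  have h6 := finrank_map_le (LinearMap.range A).mkQ Y
  omega

/-- A space of linear maps `V → W` all of whose members have rank at most `q` maps a subspace of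
codimension at most `2 q` into a subspace of dimension at most `2 q`, over any field. -/
theorem exists_compression {X : Type w} [AddCommGroup X] [Module F X] (q : ℕ) :
    ∀ {V : Type u} {W : Type v} [AddCommGroup V] [Module F V] [AddCommGroup W] [Module F W]
      [FiniteDimensional F V] [FiniteDimensional F W] (B : X →ₗ[F] V →ₗ[F] W),
      (∀ x, finrank F (LinearMap.range (B x)) ≤ q) →
      ∃ (U : Submodule F V) (W' : Submodule F W), finrank F V ≤ finrank F U + 2 * q ∧
        finrank F W' ≤ 2 * q ∧ ∀ x, ∀ y ∈ U, B x y ∈ W' := by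
  induction q using Nat.strong_induction_on with
  | _ q ih =>
    intro V W _ _ _ _ _ _ B hB
    rcases Nat.eq_zero_or_pos q with rfl | hq
    · refine ⟨⊤, ⊥, by simp, by simp, fun x y _ => ?_⟩
      have h0 : LinearMap.range (B x) = ⊥ := finrank_eq_zero.1 (Nat.le_zero.1 (hB x))
      rw [← h0]
      exact ⟨y, rfl⟩
    by_cases hmax : ∃ x, finrank F (LinearMap.range (B x)) = q
    · obtain ⟨x₀, hx₀⟩ := hmax
      obtain ⟨U, W', hU, hW', hUW⟩ := ih (q / 2) (by omega)
        ((B.compr₂ (LinearMap.range (B x₀)).mkQ).compl₂ (LinearMap.ker (B x₀)).subtype)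
        (fun x => by
          have h := finrank_residual_le (B x₀) (B x) hx₀ (hB x) (by rw [← map_add]; exact hB _)
          refine le_trans (finrank_mono ?_) h
          rintro _ ⟨y, rfl⟩
          exact ⟨B x y, ⟨y, y.2, rfl⟩, rfl⟩)
      refine ⟨U.map (LinearMap.ker (B x₀)).subtype, W'.comap (LinearMap.range (B x₀)).mkQ,
        ?_, ?_, ?_⟩
      · have h := LinearMap.finrank_range_add_finrank_ker (B x₀)
        rw [finrank_map_subtype_eq]
        omega
      · rw [finrank_comap_mkQ]
        omega
      · rintro x _ ⟨y, hy, rfl⟩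
        exact hUW x y hy
    · push Not at hmax
      obtain ⟨U, W', hU, hW', hUW⟩ := ih (q - 1) (by omega) B
        (fun x => by have := hB x; have := hmax x; omega)
      exact ⟨U, W', by omega, by omega, hUW⟩

theorem finrank_finset_sup_le {ι : Type u} {W : Type v} [AddCommGroup W] [Module F W]
    [FiniteDimensional F W] (s : Finset ι) (R : ι → Submodule F W) {b : ℕ}
    (hR : ∀ i, finrank F (R i) ≤ b) : finrank F (s.sup R : Submodule F W) ≤ s.card * b := by
  classical
  induction s using Finset.induction_on with
  | empty => simp
  | insert i s hi ih =>
    rw [Finset.sup_insert, Finset.card_insert_of_notMem hi, add_mul, one_mul]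
    have := finrank_add_le_finrank_add_finrank (R i) (s.sup R)
    have := hR i
    omega

/-- A bilinear map with small rank in both partial directions has small span. -/
theorem finrank_le_of_bilinear {X : Type w} {V : Type u} {W : Type v} [AddCommGroup X] [Module F X]
    [AddCommGroup V] [Module F V] [AddCommGroup W] [Module F W] [FiniteDimensional F V]
    [FiniteDimensional F W] (B : X →ₗ[F] V →ₗ[F] W) {a b : ℕ}
    (ha : ∀ x, finrank F (LinearMap.range (B x)) ≤ a)
    (hb : ∀ y, finrank F (LinearMap.range (B.flip y)) ≤ b)
    (hspan : ∀ P : Submodule F W, (∀ x y, B x y ∈ P) → P = ⊤) :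
    finrank F W ≤ 2 * a + 2 * a * b := by
  obtain ⟨U, W', hU, hW', hUW⟩ := exists_compression a B ha
  obtain ⟨C, hC⟩ := U.exists_isCompl
  have hCU := finrank_add_eq_of_isCompl hC
  let e := Module.finBasis F C
  set S := (Finset.univ : Finset (Fin (finrank F C))).sup
    fun i => LinearMap.range (B.flip (e i : V))
  have hS : finrank F S ≤ finrank F C * b := by
    simpa using finrank_finset_sup_le Finset.univ
      (fun i => LinearMap.range (B.flip (e i : V))) fun i => hb _
  have hC' : ∀ x, ∀ y : C, B x y ∈ S := by
    intro x y
    rw [← e.sum_repr y]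
    simp only [coe_sum, coe_smul, map_sum, map_smul]
    refine sum_mem fun i _ => smul_mem _ _ ?_
    exact Finset.le_sup (f := fun i => LinearMap.range (B.flip (e i : V))) (Finset.mem_univ i)
      ⟨x, rfl⟩
  have htop := hspan (W' ⊔ S) fun x y => by
    have hy : y ∈ U ⊔ C := by rw [hC.sup_eq_top]; trivial
    obtain ⟨u, hu, c, hc, rfl⟩ := mem_sup.1 hy
    rw [map_add]
    exact add_mem_sup (hUW x u hu) (hC' x ⟨c, hc⟩)
  have h := finrank_add_le_finrank_add_finrank W' S
  rw [htop, finrank_top] at h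
  have : finrank F C * b ≤ 2 * a * b := Nat.mul_le_mul_right b (by omega)
  omega

end Compression

/-! ### Restrictions -/

section Restriction

variable {ι1 ι2 ι3 κ1 κ2 κ3 : Type*} [Fintype ι1] [Fintype ι2] [Fintype ι3]

theorem Restricts.swap12 {T : ι1 → ι2 → ι3 → F} {S : κ1 → κ2 → κ3 → F}
    (h : Restricts (fun j i k => T i j k) (fun b a c => S a b c)) : Restricts T S := by
  obtain ⟨L2, L1, L3, h⟩ := h
  refine ⟨L1, L2, L3, fun a b c => (h b a c).trans ?_⟩
  rw [Finset.sum_comm]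
  simp only [mul_comm (L2 b _)]

theorem Restricts.swap23 {T : ι1 → ι2 → ι3 → F} {S : κ1 → κ2 → κ3 → F}
    (h : Restricts (fun i k j => T i j k) (fun a c b => S a b c)) : Restricts T S := by
  obtain ⟨L1, L3, L2, h⟩ := h
  refine ⟨L1, L2, L3, fun a b c => (h a c b).trans (Finset.sum_congr rfl fun i _ => ?_)⟩
  rw [Finset.sum_comm]
  simp only [mul_right_comm]

theorem sum_append {ι M : Type*} [Fintype ι] [AddCommMonoid M] (m n : ℕ)
    (f : (Fin (m + n) → ι) → M) :
    ∑ x, f x = ∑ y : Fin m → ι, ∑ z : Fin n → ι, f (Fin.append y z) := by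
  rw [← (Fin.appendEquiv m n).sum_comp, Fintype.sum_prod_type]
  rfl

theorem kronPow_append {α β γ : Type*} (T : α → β → γ → F) (m n : ℕ) (x : Fin m → α)
    (x' : Fin n → α) (y : Fin m → β) (y' : Fin n → β) (z : Fin m → γ) (z' : Fin n → γ) :
    kronPow T (m + n) (Fin.append x x') (Fin.append y y') (Fin.append z z') =
      kronPow T m x y z * kronPow T n x' y' z' := by
  simp [kronPow, Fin.prod_univ_add]

/-- Restrictions of two Kronecker powers multiply pointwise on the diagonal. -/
theorem Restricts.kronPow_add {T : ι1 → ι2 → ι3 → F} {m n : ℕ} {S S' : κ1 → κ2 → κ3 → F}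
    (h : Restricts (kronPow T m) S) (h' : Restricts (kronPow T n) S') :
    Restricts (kronPow T (m + n)) fun a b c => S a b c * S' a b c := by
  obtain ⟨L1, L2, L3, h⟩ := h
  obtain ⟨M1, M2, M3, h'⟩ := h'
  refine ⟨fun a x => L1 a (fun i => x (Fin.castAdd n i)) * M1 a (fun i => x (Fin.natAdd m i)),
    fun a x => L2 a (fun i => x (Fin.castAdd n i)) * M2 a (fun i => x (Fin.natAdd m i)),
    fun a x => L3 a (fun i => x (Fin.castAdd n i)) * M3 a (fun i => x (Fin.natAdd m i)),
    fun a b c => ?_⟩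
  simp only [sum_append, kronPow_append, Fin.append_left, Fin.append_right, h, h']
  rw [Finset.sum_mul_sum]
  refine Finset.sum_congr rfl fun x _ => Finset.sum_congr rfl fun x' _ => ?_
  rw [Finset.sum_mul_sum]
  refine Finset.sum_congr rfl fun y _ => Finset.sum_congr rfl fun y' _ => ?_
  rw [Finset.sum_mul_sum]
  refine Finset.sum_congr rfl fun z _ => Finset.sum_congr rfl fun z' _ => ?_
  ring

theorem le_card_of_restricts {T : ι1 → ι2 → ι3 → F} {r : ℕ}
    (h : Restricts T (unitTensor F r)) : r ≤ Fintype.card ι1 := by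
  obtain ⟨L1, L2, L3, h⟩ := h
  have hli : LinearIndependent F L1 := by
    rw [Fintype.linearIndependent_iff]
    intro w hw b
    have h1 : ∑ a, w a * unitTensor F r a b b = w b := by
      simp [unitTensor]
    rw [← h1]
    simp only [h, Finset.mul_sum]
    rw [Finset.sum_comm]
    refine Finset.sum_eq_zero fun i _ => ?_
    have h2 : ∑ a, w a * L1 a i = 0 := by
      simpa using congrFun hw i
    rw [Finset.sum_comm]
    refine Finset.sum_eq_zero fun j _ => ?_
    rw [Finset.sum_comm]
    refine Finset.sum_eq_zero fun k _ => ?_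
    calc ∑ a, w a * (L1 a i * L2 b j * L3 b k * T i j k)
        = (∑ a, w a * L1 a i) * (L2 b j * L3 b k * T i j k) := by
          rw [Finset.sum_mul]; exact Finset.sum_congr rfl fun a _ => by ring
      _ = 0 := by rw [h2, zero_mul]
  simpa using hli.fintype_card_le_finrank

theorem le_subrank_of_restricts {T : ι1 → ι2 → ι3 → F} {r : ℕ}
    (h : Restricts T (unitTensor F r)) : r ≤ subrank T :=
  le_csSup ⟨Fintype.card ι1, fun _ h' => le_card_of_restricts h'⟩ h

theorem subrank_le_card (T : ι1 → ι2 → ι3 → F) : subrank T ≤ Fintype.card ι1 :=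
  csSup_le' fun _ h => le_card_of_restricts h

theorem subrank_kronPow_rpow_le_asympSubrank (T : ι1 → ι2 → ι3 → F) (m : ℕ) :
    (subrank (kronPow T (m + 1)) : ℝ) ^ ((1 : ℝ) / (m + 1)) ≤ asympSubrank T := by
  classical
  refine le_ciSup (f := fun m : ℕ =>
    (subrank (kronPow T (m + 1)) : ℝ) ^ ((1 : ℝ) / (m + 1))) ⟨Fintype.card ι1, ?_⟩ m
  rintro _ ⟨m, rfl⟩
  have h : (subrank (kronPow T (m + 1)) : ℝ) ≤ (Fintype.card ι1 : ℝ) ^ (m + 1) := by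
    have := subrank_le_card (kronPow T (m + 1))
    rw [Fintype.card_fun, Fintype.card_fin] at this
    exact_mod_cast this
  calc (subrank (kronPow T (m + 1)) : ℝ) ^ ((1 : ℝ) / (m + 1))
      ≤ ((Fintype.card ι1 : ℝ) ^ (m + 1)) ^ ((1 : ℝ) / (m + 1)) := by gcongr
    _ = Fintype.card ι1 := by
      have := Real.pow_rpow_inv_natCast (Nat.cast_nonneg' (Fintype.card ι1) : (0 : ℝ) ≤ _)
        (Nat.succ_ne_zero m)
      simpa using this

end Restriction

/-! ### Contractions of large rank -/

section Contraction

variable {ι1 ι2 ι3 : Type*} [Fintype ι1] [Fintype ι2] [Fintype ι3]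

/-- The flattening of `T` along the third direction has a right inverse. -/
def RightInvertible (T : ι1 → ι2 → ι3 → F) : Prop :=
  ∃ G : ι1 → ι2 → ι3 → F, ∀ k w : ι3, [Decidable (k = w)] →
    ∑ i, ∑ j, T i j k * G i j w = if k = w then 1 else 0

theorem rightInvertible_of_rank {T : ι1 → ι2 → ι3 → F}
    (h : (flattening3 T).rank = Fintype.card ι3) : RightInvertible T := by
  classical
  have hs : Function.Surjective (flattening3 T).mulVecLin := by
    rw [← LinearMap.range_eq_top]
    apply Submodule.eq_top_of_finrank_eq
    rw [Module.finrank_fintype_fun_eq_card]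
    exact h
  obtain ⟨G, hG⟩ := Matrix.mulVec_surjective_iff_exists_right_inverse.1 hs
  refine ⟨fun i j w => G (i, j) w, fun k w _ => ?_⟩
  have := congrFun (congrFun hG k) w
  rw [Matrix.mul_apply, Fintype.sum_prod_type, Matrix.one_apply] at this
  refine Eq.trans this ?_
  congr

theorem RightInvertible.pow {γ : Type*} {T : ι1 → ι2 → γ → F} (h : RightInvertible T) (m : ℕ) :
    RightInvertible (kronPow T m) := by
  classical
  obtain ⟨G, hG⟩ := h
  refine ⟨kronPow G m, fun k w _ => ?_⟩
  have h1 : ∀ x : Fin m → ι1, ∑ y : Fin m → ι2, kronPow T m x y k * kronPow G m x y w =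
      ∏ s, ∑ j, T (x s) j (k s) * G (x s) j (w s) := by
    intro x
    simp only [kronPow, ← Finset.prod_mul_distrib]
    rw [Fintype.prod_sum]
  simp only [h1]
  rw [← Fintype.prod_sum fun s i => ∑ j, T i j (k s) * G i j (w s)]
  simp only [hG]
  rw [Finset.prod_ite_zero]
  simp [funext_iff]

/-- The bilinear map `(x, y) ↦ T(x, y, ·)`. -/
def bilin {γ : Type*} (T : ι1 → ι2 → γ → F) : (ι1 → F) →ₗ[F] (ι2 → F) →ₗ[F] (γ → F) :=
  LinearMap.mk₂ F (fun x y k => ∑ i, ∑ j, x i * y j * T i j k)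
    (fun x x' y => by ext k; simp [add_mul, Finset.sum_add_distrib])
    (fun c x y => by ext k; simp [Finset.mul_sum, mul_assoc])
    (fun x y y' => by ext k; simp [mul_add, add_mul, Finset.sum_add_distrib])
    (fun c x y => by ext k; simp [Finset.mul_sum, mul_assoc, mul_left_comm])

theorem bilin_apply {γ : Type*} (T : ι1 → ι2 → γ → F) (x : ι1 → F) (y : ι2 → F) (k : γ) :
    bilin T x y k = ∑ i, ∑ j, x i * y j * T i j k := rfl

theorem RightInvertible.eq_top {T : ι1 → ι2 → ι3 → F} (h : RightInvertible T)
    (P : Submodule F (ι3 → F)) (hP : ∀ x y, bilin T x y ∈ P) : P = ⊤ := by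
  classical
  obtain ⟨G, hG⟩ := h
  have hT : ∀ i j, T i j ∈ P := by
    intro i j
    convert hP (Pi.single i 1) (Pi.single j 1) using 1
    ext k
    simp [bilin_apply, Pi.single_apply]
  rw [eq_top_iff, ← (Pi.basisFun F ι3).span_eq, Submodule.span_le]
  rintro _ ⟨w, rfl⟩
  have : Pi.basisFun F ι3 w = ∑ i, ∑ j, G i j w • T i j := by
    ext k
    simp [Pi.single_apply, ← hG k w, mul_comm]
  rw [this]
  exact sum_mem fun i _ => sum_mem fun j _ => P.smul_mem _ (hT i j)

/-- A linear map of rank at least `s` restricts to the identity of size `s`. -/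
theorem exists_dual_pairs {V : Type*} [AddCommGroup V] [Module F V] [Module.Finite F V]
    (f : V →ₗ[F] ι3 → F) {s : ℕ} (h : s ≤ Module.finrank F (LinearMap.range f)) :
    ∃ (P : Fin s → V) (Q : Fin s → ι3 → F),
      ∀ b c, ∑ k, Q c k * f (P b) k = if b = c then 1 else 0 := by
  classical
  obtain ⟨v, hv⟩ := exists_linearIndependent_of_le_finrank h
  choose P hP using fun b => (v b).2
  have hv' : LinearIndependent F fun b => (v b : ι3 → F) :=
    hv.map' (LinearMap.range f).subtype (Submodule.ker_subtype _)
  obtain ⟨g, hg⟩ := LinearMap.exists_leftInverse_of_injective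
    (Fintype.linearCombination F fun b => (v b : ι3 → F))
    (LinearMap.ker_eq_bot.2 hv'.fintypeLinearCombination_injective)
  refine ⟨P, fun c k => g (Pi.single k 1) c, fun b c => ?_⟩
  have h1 : g (v b) = Pi.single b 1 := by
    have := LinearMap.congr_fun hg (Pi.single b 1)
    simpa [Fintype.linearCombination_apply, Pi.single_apply] using this
  have h2 : g (v b) c = ∑ k, (v b : ι3 → F) k * g (Pi.single k 1) c := by
    conv_lhs => rw [← Finset.univ_sum_single (v b : ι3 → F)]
    rw [map_sum, Finset.sum_apply]
    refine Finset.sum_congr rfl fun k _ => ?_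
    rw [← smul_eq_mul, ← Pi.smul_apply, ← map_smul, ← Pi.single_smul, smul_eq_mul, mul_one]
  rw [h1] at h2
  simp only [hP, mul_comm (g _ c)]
  rw [← h2, Pi.single_apply]
  simp [eq_comm]

/-- A tensor with right invertible third flattening has a contraction of large rank along the
first or along the second direction. -/
theorem RightInvertible.restricts_or {T : ι1 → ι2 → ι3 → F} (h : RightInvertible T) {r : ℕ}
    (hr : 2 * r + 2 * r * r < Fintype.card ι3) :
    Restricts T (fun _ b c : Fin (r + 1) => if b = c then (1 : F) else 0) ∨
      Restricts T (fun a _ c : Fin (r + 1) => if a = c then (1 : F) else 0) := by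
  by_contra! hcon
  obtain ⟨h1, h2⟩ := hcon
  refine hr.not_ge ?_
  rw [← Module.finrank_fintype_fun_eq_card (R := F)]
  refine finrank_le_of_bilinear (bilin T) (fun x => ?_) (fun y => ?_) h.eq_top
  · by_contra! hx
    obtain ⟨P, Q, hPQ⟩ := exists_dual_pairs _ hx
    refine h1 ⟨fun _ => x, P, Q, fun a b c => (hPQ b c).symm.trans ?_⟩
    simp only [bilin_apply, Finset.mul_sum]
    rw [Finset.sum_comm]
    refine Finset.sum_congr rfl fun i _ => ?_
    rw [Finset.sum_comm]
    exact Finset.sum_congr rfl fun j _ => Finset.sum_congr rfl fun k _ => by ring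
  · by_contra! hy
    obtain ⟨P, Q, hPQ⟩ := exists_dual_pairs _ hy
    refine h2 ⟨P, fun _ => y, Q, fun a b c => (hPQ a c).symm.trans ?_⟩
    simp only [LinearMap.flip_apply, bilin_apply, Finset.mul_sum]
    rw [Finset.sum_comm]
    refine Finset.sum_congr rfl fun i _ => ?_
    rw [Finset.sum_comm]
    exact Finset.sum_congr rfl fun j _ => Finset.sum_congr rfl fun k _ => by ring

end Contraction

/-! ### The asymptotic subrank of concise tensors -/

theorem Restricts.unitTensor_of_two {n1 n2 n3 : ℕ} {T : Fin n1 → Fin n2 → Fin n3 → F} {m s : ℕ}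
    {S S' : Fin s → Fin s → Fin s → F} (h : Restricts (kronPow T m) S)
    (h' : Restricts (kronPow T m) S') (hS : ∀ a b c, S a b c * S' a b c = unitTensor F s a b c) :
    s ≤ subrank (kronPow T (m + m)) := by
  refine le_subrank_of_restricts ?_
  have := h.kronPow_add h'
  simp only [hS] at this
  exact this

/-- For concise `T`, two Kronecker copies of `T^{⊠ m}` have subrank of order at least the square
root of the `m`-th power of the smallest side. -/
theorem le_subrank_kronPow_add_self {n1 n2 n3 : ℕ} {T : Fin n1 → Fin n2 → Fin n3 → F}
    (hT : Concise T) (m : ℕ) {r : ℕ} (hr : 2 * r + 2 * r * r < min (min n1 n2) n3 ^ m) :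
    r + 1 ≤ subrank (kronPow T (m + m)) := by
  have hcard : ∀ n, min (min n1 n2) n3 ≤ n →
      2 * r + 2 * r * r < Fintype.card (Fin m → Fin n) := fun n hn => by
    rw [Fintype.card_fun, Fintype.card_fin, Fintype.card_fin]
    exact hr.trans_le (Nat.pow_le_pow_left hn m)
  have hT1 : RightInvertible fun j k i => T i j k := by
    refine rightInvertible_of_rank ?_
    exact hT.1
  have hT2 : RightInvertible fun i k j => T i j k := by
    refine rightInvertible_of_rank ?_
    exact hT.2.1
  have hT3 : RightInvertible T := rightInvertible_of_rank hT.2.2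
  have h12 := (hT3.pow m).restricts_or (hcard n3 (min_le_right _ _))
  have h13 : Restricts (kronPow T m) (fun _ b c : Fin (r + 1) => if b = c then (1 : F) else 0) ∨
      Restricts (kronPow T m) (fun a b _ : Fin (r + 1) => if a = b then (1 : F) else 0) := by
    refine ((hT2.pow m).restricts_or (hcard n2 (by simp))).imp (fun h => ?_) (fun h => ?_)
    · refine Restricts.swap23 (Eq.mp (congrArg (Restricts _) ?_) h)
      funext a c b
      simp only [eq_comm]
    · exact Restricts.swap23 h
  have h23 : Restricts (kronPow T m) (fun a _ c : Fin (r + 1) => if a = c then (1 : F) else 0) ∨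
      Restricts (kronPow T m) (fun a b _ : Fin (r + 1) => if a = b then (1 : F) else 0) := by
    refine ((hT1.pow m).restricts_or (hcard n1 (by simp))).imp (fun h => ?_) (fun h => ?_)
    · refine Restricts.swap12 (Restricts.swap23 ?_)
      refine Eq.mp (congrArg (Restricts _) ?_) h
      funext b c a
      simp only [eq_comm]
    · refine Restricts.swap12 (Restricts.swap23 ?_)
      refine Eq.mp (congrArg (Restricts _) ?_) h
      funext b c a
      simp only [eq_comm]
  have key : ∀ a b c : Fin (r + 1),
      (if b = c then (1 : F) else 0) * (if a = c then 1 else 0) = unitTensor F (r + 1) a b c ∧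
      (if b = c then (1 : F) else 0) * (if a = b then 1 else 0) = unitTensor F (r + 1) a b c ∧
      (if a = c then (1 : F) else 0) * (if a = b then 1 else 0) = unitTensor F (r + 1) a b c := by
    intro a b c
    simp only [unitTensor, ← ite_and, mul_ite, mul_one, mul_zero]
    grind
  rcases h12 with h | h
  · rcases h23 with h' | h'
    · exact h.unitTensor_of_two h' fun a b c => (key a b c).1
    · exact h.unitTensor_of_two h' fun a b c => (key a b c).2.1
  · rcases h13 with h' | h'
    · exact h'.unitTensor_of_two h fun a b c => (key a b c).1
    · exact h.unitTensor_of_two h' fun a b c => (key a b c).2.2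

theorem pow_le_four_mul_subrank_sq {n1 n2 n3 : ℕ} {T : Fin n1 → Fin n2 → Fin n3 → F}
    (hT : Concise T) (m : ℕ) :
    min (min n1 n2) n3 ^ m ≤ 4 * subrank (kronPow T (m + m)) ^ 2 := by
  by_contra! h
  refine (le_subrank_kronPow_add_self hT m (lt_of_le_of_lt ?_ h)).not_gt (Nat.lt_succ_self _)
  nlinarith [Nat.le_mul_self (subrank (kronPow T (m + m)))]

/-- Every concise tensor `T` of format `(n1, n2, n3)` over any field
has asymptotic subrank at least `(min {n1, n2, n3})^(1/4)`. -/
theorem asympSubrank_ge_fourthroot_min (F : Type*) [Field F] (n1 n2 n3 : ℕ)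
    (T : Fin n1 → Fin n2 → Fin n3 → F) (hT : Concise T) :
    ((min (min n1 n2) n3 : ℕ) : ℝ) ^ ((1 : ℝ) / 4) ≤ asympSubrank T := by
  set n := min (min n1 n2) n3
  have hbound : ∀ m : ℕ, (n : ℝ) ^ ((1 : ℝ) / 4) *
      (1 / 4 : ℝ) ^ ((1 : ℝ) / 4 * (1 / ((m : ℝ) + 1))) ≤ asympSubrank T := by
    intro m
    refine le_trans ?_ (subrank_kronPow_rpow_le_asympSubrank T (m + 1 + m))
    have h : ((n : ℝ) ^ (m + 1)) * (1 / 4) ≤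
        (subrank (kronPow T (m + 1 + (m + 1))) : ℝ) ^ 2 := by
      have : ((n ^ (m + 1) : ℕ) : ℝ) ≤ ((4 * subrank (kronPow T (m + 1 + (m + 1))) ^ 2 : ℕ) : ℝ) :=
        Nat.cast_le.2 (pow_le_four_mul_subrank_sq hT (m + 1))
      push_cast at this
      linarith
    have hm : (0 : ℝ) < (m : ℝ) + 1 := by positivity
    have h' := Real.rpow_le_rpow (by positivity) h
      (by positivity : (0 : ℝ) ≤ (1 : ℝ) / 4 * (1 / ((m : ℝ) + 1)))
    rw [Real.mul_rpow (by positivity) (by positivity), ← Real.rpow_natCast (n : ℝ),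
      ← Real.rpow_mul (by positivity), ← Real.rpow_natCast (subrank _ : ℝ),
      ← Real.rpow_mul (by positivity)] at h'
    have e1 : ((m + 1 : ℕ) : ℝ) * (1 / 4 * (1 / ((m : ℝ) + 1))) = 1 / 4 := by
      push_cast
      field_simp
    have e2 : ((2 : ℕ) : ℝ) * (1 / 4 * (1 / ((m : ℝ) + 1))) = 1 / (((m + 1 + m : ℕ) : ℝ) + 1) := by
      push_cast
      field_simp
      ring
    rw [e1, e2] at h'
    exact h'
  have hlim : Filter.Tendsto
      (fun m : ℕ => (n : ℝ) ^ ((1 : ℝ) / 4) * (1 / 4 : ℝ) ^ ((1 : ℝ) / 4 * (1 / ((m : ℝ) + 1))))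
      Filter.atTop (nhds ((n : ℝ) ^ ((1 : ℝ) / 4))) := by
    have h0 := (tendsto_one_div_add_atTop_nhds_zero_nat (𝕜 := ℝ)).const_mul ((1 : ℝ) / 4)
    have h1 := (((Real.continuous_const_rpow (a := (1 / 4 : ℝ)) (by norm_num)).tendsto _).comp
      h0).const_mul ((n : ℝ) ^ ((1 : ℝ) / 4))
    simpa [Function.comp_def] using h1
  exact le_of_tendsto' hlim hbound

end Paper
end
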